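/- arXiv:1007.3018 — 5 statements merged into one kernel-verified Lean document; each statement's English description precedes it below -/
import Mathlib

section
/- For a sequence x : ℕ → ℝ and a real L, the sequence x tends to L (in the sense of Filter.Tendsto x atTop (nhds L)) if and only if for every h : ℕ → ℕ representing an infinite hypernatural, IsSt (ofSeq (x ∘ h)) L; i.e., L = lim x_n exactly when the standard part of x_H equals L for all infinite H. -/
/-- An `ℕ`-valued function tends to infinity along a filter `l` exactly when it eventually exceeds
every natural number. -/
theorem Nat.tendsto_atTop_iff_eventually_lt {α : Type*} {l : Filter α} {h : α → ℕ} :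
    Filter.Tendsto h l Filter.atTop ↔ ∀ k : ℕ, ∀ᶠ n in l, k < h n :=
  ⟨fun hh k => hh.eventually_gt_atTop k,
    fun hh => Filter.tendsto_atTop.2 fun k => (hh k).mono fun _ => le_of_lt⟩

/-- Convergence along `atTop` can be tested by reparametrizations that tend to infinity along any
fixed nontrivial filter finer than `atTop`. -/
theorem Filter.tendsto_atTop_iff_forall_comp {β : Type*} {l : Filter ℕ} [l.NeBot]
    (hl : l ≤ atTop) {x : ℕ → β} {m : Filter β} :
    Tendsto x atTop m ↔ ∀ h : ℕ → ℕ, Tendsto h l atTop → Tendsto (x ∘ h) l m := by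
  refine ⟨fun hx h hh => hx.comp hh, fun H => ?_⟩
  by_contra hx
  obtain ⟨s, hs, hfreq⟩ := not_tendsto_iff_exists_frequently_notMem.1 hx
  obtain ⟨φ, hφ, hφs⟩ := extraction_of_frequently_atTop hfreq
  obtain ⟨n, hn⟩ := ((H φ (hφ.tendsto_atTop.mono_left hl)).eventually_mem hs).exists
  exact hφs n hn

theorem tendsto_iff_isSt_at_infinite (x : ℕ → ℝ) (L : ℝ) :
    Filter.Tendsto x Filter.atTop (nhds L) ↔
      ∀ h : ℕ → ℕ, (∀ k : ℕ, {n | k < h n} ∈ Filter.hyperfilter ℕ) →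
        Hyperreal.IsSt (Hyperreal.ofSeq (x ∘ h)) L := by
  rw [Filter.tendsto_atTop_iff_forall_comp Nat.hyperfilter_le_atTop]
  exact forall_congr' fun _ =>
    imp_congr Nat.tendsto_atTop_iff_eventually_lt Hyperreal.isSt_ofSeq_iff_tendsto.symm
end

section
/- For f : ℝ → ℝ, a : ℝ and L : ℝ, one has Filter.Tendsto f (nhdsWithin a {a}ᶜ) (nhds L) if and only if for every hyperreal x with x ≠ (a : ℝ*) and IsSt x a, one has IsSt (Germ.map f x) L; i.e., lim_{x→a} f(x) = L exactly when the difference x - a being a nonzero infinitesimal forces f*(x) - L to be infinitesimal. -/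
/-- A hyperreal differs from a standard real iff a representing sequence does so eventually along
the hyperfilter. -/
theorem Hyperreal.ofSeq_ne_coe_iff {u : ℕ → ℝ} {a : ℝ} :
    Hyperreal.ofSeq u ≠ (a : ℝ*) ↔ ∀ᶠ n in (Filter.hyperfilter ℕ : Filter ℕ), u n ≠ a := by
  rw [Ultrafilter.eventually_not]
  exact not_congr Filter.Germ.coe_eq

set_option linter.deprecated false in
theorem tendsto_nhdsWithin_iff_isSt (f : ℝ → ℝ) (a L : ℝ) :
    Filter.Tendsto f (nhdsWithin a {a}ᶜ) (nhds L) ↔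
      ∀ x : ℝ*, x ≠ (a : ℝ*) → Hyperreal.IsSt x a →
        Hyperreal.IsSt (Filter.Germ.map f x) L := by
  constructor
  · intro hf x hxa hx
    obtain ⟨u, rfl⟩ := Hyperreal.ofSeq_surjective x
    rw [Hyperreal.isSt_ofSeq_iff_tendsto] at hx
    exact Hyperreal.isSt_ofSeq_iff_tendsto.2
      (hf.comp (tendsto_nhdsWithin_iff.2 ⟨hx, Hyperreal.ofSeq_ne_coe_iff.1 hxa⟩))
  · intro h
    by_contra hf
    obtain ⟨s, hs, hfs⟩ := Filter.not_tendsto_iff_exists_frequently_notMem.1 hf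
    obtain ⟨u, hu, hus⟩ := Filter.exists_seq_forall_of_frequently hfs
    obtain ⟨hua, hune⟩ :=
      tendsto_nhdsWithin_iff.1 (hu.mono_left Nat.hyperfilter_le_atTop)
    have hfu : Filter.Tendsto (f ∘ u) (Filter.hyperfilter ℕ) (nhds L) :=
      Hyperreal.isSt_ofSeq_iff_tendsto.1
        (h (Hyperreal.ofSeq u) (Hyperreal.ofSeq_ne_coe_iff.2 hune)
          (Hyperreal.isSt_ofSeq_iff_tendsto.2 hua))
    obtain ⟨n, hn⟩ := (hfu.eventually_mem hs).exists
    exact hus n hn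
end

section
/- For f : ℝ → ℝ and a : ℝ, f is continuous at a if and only if for every hyperreal y with IsSt y a one has IsSt (Germ.map f y) (f a); i.e., f is continuous at a exactly when y ≈ a implies f*(y) ≈ f(a). -/
set_option linter.deprecated false in
theorem continuousAt_iff_isSt (f : ℝ → ℝ) (a : ℝ) :
    ContinuousAt f a ↔
      ∀ y : ℝ*, Hyperreal.IsSt y a →
        Hyperreal.IsSt (Filter.Germ.map f y) (f a) := by
  refine ⟨fun hf y hy ↦ hy.map hf, fun h ↦ ?_⟩
  by_contra hf
  obtain ⟨s, hs, hfs⟩ := Filter.not_tendsto_iff_exists_frequently_notMem.1 hf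
  obtain ⟨u, hu, hus⟩ := Filter.exists_seq_forall_of_frequently hfs
  have hfu : Filter.Tendsto (f ∘ u) (Filter.hyperfilter ℕ) (nhds (f a)) :=
    Hyperreal.isSt_ofSeq_iff_tendsto.1 (h (Hyperreal.ofSeq u) (Hyperreal.isSt_of_tendsto hu))
  obtain ⟨n, hn⟩ := (hfu.eventually hs).exists
  exact hus n hn
end

section
/- A function f : ℝ → ℝ is uniformly continuous if and only if for all hyperreals x, y with x - y infinitesimal, the difference Germ.map f x - Germ.map f y is infinitesimal; i.e., f is uniformly continuous exactly when x ≈ y implies f*(x) ≈ f*(y) for all hyperreal x, y. -/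
set_option linter.deprecated false in
theorem Hyperreal.infinitesimal_ofSeq_sub_iff {a b : ℕ → ℝ} :
    Hyperreal.Infinitesimal (Hyperreal.ofSeq a - Hyperreal.ofSeq b) ↔
      ∀ ε > 0, ∀ᶠ n in (Filter.hyperfilter ℕ : Filter ℕ), dist (a n) (b n) < ε := by
  have h : Hyperreal.Infinitesimal (Hyperreal.ofSeq a - Hyperreal.ofSeq b) ↔
      Filter.Tendsto (fun n => a n - b n) (Filter.hyperfilter ℕ) (nhds 0) :=
    Hyperreal.isSt_ofSeq_iff_tendsto
  rw [h, Metric.tendsto_nhds]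
  simp only [Real.dist_eq, sub_zero]

set_option linter.deprecated false in
theorem uniformContinuous_iff_infinitesimal (f : ℝ → ℝ) :
    UniformContinuous f ↔
      ∀ x y : ℝ*, Hyperreal.Infinitesimal (x - y) →
        Hyperreal.Infinitesimal (Filter.Germ.map f x - Filter.Germ.map f y) := by
  rw [Metric.uniformContinuous_iff]
  constructor
  · intro hf x y hxy
    obtain ⟨a, rfl⟩ := Hyperreal.ofSeq_surjective x
    obtain ⟨b, rfl⟩ := Hyperreal.ofSeq_surjective y
    refine Hyperreal.infinitesimal_ofSeq_sub_iff (a := f ∘ a) (b := f ∘ b) |>.2 fun ε hε => ?_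
    obtain ⟨δ, hδ, hfδ⟩ := hf ε hε
    exact (Hyperreal.infinitesimal_ofSeq_sub_iff.1 hxy δ hδ).mono fun n hn => hfδ hn
  · intro h
    by_contra! ⟨ε, hε, hbad⟩
    choose a b hab hfab using fun n : ℕ => hbad (1 / ((n : ℝ) + 1)) Nat.one_div_pos_of_nat
    have hclose : Hyperreal.Infinitesimal (Hyperreal.ofSeq a - Hyperreal.ofSeq b) := by
      refine Hyperreal.infinitesimal_ofSeq_sub_iff.2 fun δ hδ => ?_
      have hlim := (tendsto_one_div_add_atTop_nhds_zero_nat (𝕜 := ℝ)).eventually_lt_const hδ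
      exact (hlim.filter_mono Nat.hyperfilter_le_atTop).mono fun n hn => (hab n).trans hn
    have himage := Hyperreal.infinitesimal_ofSeq_sub_iff (a := f ∘ a) (b := f ∘ b) |>.1
      (h _ _ hclose) ε hε
    obtain ⟨n, hn⟩ := himage.exists
    exact (hfab n).not_gt hn
end

section
/- For f : ℝ → ℝ, a : ℝ and d : ℝ, f has derivative d at a (HasDerivAt f d a) if and only if for every nonzero infinitesimal ε : ℝ*, IsSt ((Germ.map f ((a : ℝ*) + ε) - (f a : ℝ*)) / ε) d; i.e., f'(a) = st((f(a+ε) - f(a))/ε) independently of the choice of nonzero infinitesimal ε. -/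
open Filter Topology

set_option linter.deprecated false

namespace Hyperreal

theorem ofSeq_ne_zero_iff {u : ℕ → ℝ} : ofSeq u ≠ 0 ↔ ∀ᶠ n in hyperfilter ℕ, u n ≠ 0 := by
  rw [Ultrafilter.eventually_not]
  exact not_congr Germ.coe_eq

theorem infinitesimal_ofSeq_iff {u : ℕ → ℝ} :
    Infinitesimal (ofSeq u) ↔ Tendsto u (hyperfilter ℕ) (𝓝 0) :=
  isSt_ofSeq_iff_tendsto

end Hyperreal

/-- A limit along a countably generated filter can be tested on ultrafilter limits of sequences. -/
theorem Filter.tendsto_of_forall_tendsto_hyperfilter {α β : Type*} {k : Filter α} {l : Filter β}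
    [k.IsCountablyGenerated] {g : α → β}
    (h : ∀ u : ℕ → α, Tendsto u (hyperfilter ℕ) k → Tendsto (g ∘ u) (hyperfilter ℕ) l) :
    Tendsto g k l := by
  intro s hs
  by_contra hg
  obtain ⟨u, hu, hus⟩ := exists_seq_forall_of_frequently (l := k) (p := fun x ↦ g x ∉ s)
    (not_eventually.1 hg)
  obtain ⟨n, hn⟩ := ((h u (hu.mono_left Nat.hyperfilter_le_atTop)).eventually_mem hs).exists
  exact hus n hn

theorem hasDerivAt_iff_isSt (f : ℝ → ℝ) (a d : ℝ) :
    HasDerivAt f d a ↔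
      ∀ ε : ℝ*, ε ≠ 0 → Hyperreal.Infinitesimal ε →
        Hyperreal.IsSt
          (Sub.sub (α := ℝ*) (Filter.Germ.map f ((a : ℝ*) + ε)) ((f a : ℝ) : ℝ*) / ε) d := by
  have key (u : ℕ → ℝ) :
      Hyperreal.IsSt (Sub.sub (α := ℝ*) (Filter.Germ.map f ((a : ℝ*) + Hyperreal.ofSeq u))
        ((f a : ℝ) : ℝ*) / Hyperreal.ofSeq u) d ↔
      Tendsto (fun n ↦ (u n)⁻¹ • (f (a + u n) - f a)) (hyperfilter ℕ) (𝓝 d) := by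
    simp only [smul_eq_mul, ← div_eq_inv_mul]
    exact Hyperreal.isSt_ofSeq_iff_tendsto (f := fun n ↦ (f (a + u n) - f a) / u n)
  rw [hasDerivAt_iff_tendsto_slope_zero]
  constructor
  · intro h ε hε hinf
    obtain ⟨u, rfl⟩ := Hyperreal.ofSeq_surjective ε
    exact (key u).2 (h.comp (tendsto_nhdsWithin_iff.2
      ⟨Hyperreal.infinitesimal_ofSeq_iff.1 hinf, Hyperreal.ofSeq_ne_zero_iff.1 hε⟩))
  · intro h
    refine tendsto_of_forall_tendsto_hyperfilter fun u hu ↦ ?_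
    obtain ⟨hu0, hne⟩ := tendsto_nhdsWithin_iff.1 hu
    exact (key u).1 (h _ (Hyperreal.ofSeq_ne_zero_iff.2 hne)
      (Hyperreal.infinitesimal_ofSeq_iff.2 hu0))
end
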